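/- Let k ≥ 3 be an integer and let λ = (3, 2^{k−1}) be the partition with first part 3 and k−1 parts equal to 2. Then for any number of variables n ≥ k, the symmetric polynomial (s_λ^{(1)})^2 − s_λ · s_λ^{(2)} in the variables x_1,…,x_n is Schur positive. -/

import Mathlib

open MvPolynomial

noncomputable section

/-- The complete homogeneous symmetric polynomial in `n` variables, indexed by an
integer (by convention it is `0` for negative indices). -/
def hInt (n : ℕ) (k : ℤ) : MvPolynomial (Fin n) ℚ :=
  if 0 ≤ k then MvPolynomial.hsymm (Fin n) ℚ k.toNat else 0

/-- The number of (nonzero) parts of a partition `lam : ℕ → ℕ` (parts are indexed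
starting from `0`). -/
def partLen (lam : ℕ → ℕ) : ℕ := sInf {N | lam N = 0}

/-- A partition, recorded as a weakly decreasing, eventually zero function `ℕ → ℕ`
listing its parts (indexed starting from `0`). -/
def IsPartition (lam : ℕ → ℕ) : Prop := Antitone lam ∧ ∃ N, ∀ i, N ≤ i → lam i = 0

/-- The Schur polynomial of a partition in `n` variables, via the Jacobi-Trudi identity
`s_lam = det (h_{lam_i + j - i})`. -/
def schur (n : ℕ) (lam : ℕ → ℕ) : MvPolynomial (Fin n) ℚ :=
  (Matrix.of fun i j : Fin (partLen lam) =>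
    hInt n ((lam i : ℤ) + ((j : ℕ) : ℤ) - ((i : ℕ) : ℤ))).det

/-- The `i`-th derived polynomial `p^{(i)}` of `p`, defined by the identity
`p (x₁ + t, …, xₙ + t) = ∑ i, t^i • p^{(i)} (x₁, …, xₙ)`: substituting `X j + t` for each
variable `X j` yields a polynomial in `t` whose `t^i`-coefficient is `p^{(i)}`. -/
def derived (n i : ℕ) (p : MvPolynomial (Fin n) ℚ) : MvPolynomial (Fin n) ℚ :=
  (MvPolynomial.aeval
    (fun j : Fin n => (Polynomial.C (X j) + Polynomial.X : Polynomial (MvPolynomial (Fin n) ℚ)))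
    p).coeff i

/-- A symmetric polynomial is Schur positive if it is a linear combination of Schur
polynomials (of partitions) with non-negative coefficients. -/
def SchurPositive (n : ℕ) (f : MvPolynomial (Fin n) ℚ) : Prop :=
  ∃ (S : Finset (ℕ → ℕ)) (c : (ℕ → ℕ) → ℚ),
    (∀ μ ∈ S, IsPartition μ) ∧ (∀ μ ∈ S, 0 ≤ c μ) ∧ f = ∑ μ ∈ S, c μ • schur n μ

lemma hsymm_eq_sum_finsuppAntidiag (n d : ℕ) :
    hsymm (Fin n) ℚ d =
      ∑ f ∈ Finset.univ.finsuppAntidiag d, ∏ i, (X i : MvPolynomial (Fin n) ℚ) ^ f i := by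
  rw [hsymm]
  refine Finset.sum_bij' (fun s _ => Multiset.toFinsupp s.1)
    (fun f hf => ⟨Finsupp.toMultiset f, ?_⟩) ?_ ?_ ?_ ?_ ?_
  · rw [Finset.mem_finsuppAntidiag] at hf
    rw [Finsupp.card_toMultiset, Finsupp.sum_fintype _ _ (by simp)]
    exact hf.1
  · intro s _
    rw [Finset.mem_finsuppAntidiag]
    refine ⟨?_, Finset.subset_univ _⟩
    change ∑ i, Multiset.toFinsupp s.1 i = d
    simp only [Multiset.toFinsupp_apply]
    rw [Multiset.sum_count_eq_card (fun a _ => Finset.mem_univ a)]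
    exact s.2
  · intro f _
    exact Finset.mem_univ _
  · intro s _
    exact Subtype.ext (by simp)
  · intro f _
    simp
  · intro s _
    simp only [Multiset.toFinsupp_apply]
    exact Finset.prod_multiset_map_count _ _ |>.trans
      (Finset.prod_subset (Finset.subset_univ _) (by
        intro i _ hi
        rw [Multiset.mem_toFinset] at hi
        rw [Multiset.count_eq_zero_of_notMem hi, pow_zero]))

/-- The elementary symmetric polynomial indexed by an integer, `0` for negative indices. -/
def eInt (n : ℕ) (k : ℤ) : MvPolynomial (Fin n) ℚ :=
  if 0 ≤ k then esymm (Fin n) ℚ k.toNat else 0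

lemma hInt_natCast (n k : ℕ) : hInt n k = hsymm (Fin n) ℚ k := by simp [hInt]

lemma eInt_natCast (n k : ℕ) : eInt n k = esymm (Fin n) ℚ k := by simp [eInt]

lemma hInt_neg {n : ℕ} {k : ℤ} (h : k < 0) : hInt n k = 0 := by simp [hInt, h]

lemma eInt_neg {n : ℕ} {k : ℤ} (h : k < 0) : eInt n k = 0 := by simp [eInt, h]

@[simp] lemma hInt_zero (n : ℕ) : hInt n 0 = 1 := by simp [hInt]

@[simp] lemma eInt_zero (n : ℕ) : eInt n 0 = 1 := by simp [eInt]

lemma esymm_eq_zero_of_lt {n k : ℕ} (h : n < k) : esymm (Fin n) ℚ k = 0 := by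
  rw [esymm, Finset.powersetCard_eq_empty.2 (by simpa using h), Finset.sum_empty]

lemma eInt_eq_zero_of_lt {n : ℕ} {k : ℤ} (h : (n : ℤ) < k) : eInt n k = 0 := by
  lift k to ℕ using by omega
  rw [eInt_natCast, esymm_eq_zero_of_lt (by omega)]

lemma mk_hsymm_eq_prod (n : ℕ) :
    PowerSeries.mk (fun d => hsymm (Fin n) ℚ d) =
      ∏ i : Fin n, PowerSeries.mk (fun k => (X i : MvPolynomial (Fin n) ℚ) ^ k) := by
  ext1 d
  rw [PowerSeries.coeff_mk, hsymm_eq_sum_finsuppAntidiag, PowerSeries.coeff_prod]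
  simp

lemma mk_esymm_eq_prod (n : ℕ) :
    PowerSeries.mk (fun d => (-1) ^ d * esymm (Fin n) ℚ d) =
      ∏ i : Fin n,
        (1 + PowerSeries.C (-(X i : MvPolynomial (Fin n) ℚ)) * PowerSeries.X) := by
  ext1 d
  rw [PowerSeries.coeff_mk, Finset.prod_one_add, map_sum]
  simp_rw [Finset.prod_mul_distrib, Finset.prod_const, ← map_prod, PowerSeries.coeff_C_mul_X_pow]
  rw [← Finset.sum_filter, esymm, Finset.mul_sum]
  refine Finset.sum_congr ?_ ?_
  · ext s; simp [Finset.mem_powersetCard, eq_comm]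
  · intro s hs
    rw [Finset.prod_neg, (Finset.mem_filter.1 hs).2]

lemma sum_antidiagonal_esymm_mul_hsymm (n d : ℕ) :
    ∑ p ∈ Finset.HasAntidiagonal.antidiagonal d,
      (-1) ^ p.1 * esymm (Fin n) ℚ p.1 * hsymm (Fin n) ℚ p.2 = if d = 0 then 1 else 0 := by
  have h : PowerSeries.mk (fun d => (-1) ^ d * esymm (Fin n) ℚ d) *
      PowerSeries.mk (fun d => hsymm (Fin n) ℚ d) = 1 := by
    rw [mk_hsymm_eq_prod, mk_esymm_eq_prod, ← Finset.prod_mul_distrib]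
    refine Finset.prod_eq_one fun i _ => ?_
    ext1 d
    rw [add_mul, one_mul, map_add, PowerSeries.coeff_mk, PowerSeries.coeff_one, mul_assoc,
      PowerSeries.coeff_C_mul]
    cases d with
    | zero => simp
    | succ d =>
      rw [PowerSeries.coeff_succ_X_mul, PowerSeries.coeff_mk, if_neg d.succ_ne_zero]
      ring
  have h2 := congrArg (PowerSeries.coeff d) h
  rw [PowerSeries.coeff_mul, PowerSeries.coeff_one] at h2
  simpa only [PowerSeries.coeff_mk] using h2

lemma sum_range_eInt_mul_hInt {n N : ℕ} {z : ℤ} (hz : z ≤ N ∨ n ≤ N) :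
    ∑ k ∈ Finset.range (N + 1), (-1) ^ k * eInt n k * hInt n (z - k) =
      if z = 0 then 1 else 0 := by
  rcases lt_or_ge z 0 with hneg | hpos
  · rw [if_neg hneg.ne]
    exact Finset.sum_eq_zero fun k _ => by rw [hInt_neg (by omega), mul_zero]
  · lift z to ℕ using hpos with d
    have key := sum_antidiagonal_esymm_mul_hsymm n d
    rw [Finset.Nat.sum_antidiagonal_eq_sum_range_succ_mk] at key
    have h1 : ∑ k ∈ Finset.range (d + 1), (-1) ^ k * eInt n k * hInt n ((d : ℤ) - k) =
        if (d : ℤ) = 0 then 1 else 0 := by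
      simp only [Nat.cast_eq_zero]
      rw [← key]
      refine Finset.sum_congr rfl fun k hk => ?_
      rw [Finset.mem_range] at hk
      rw [← Nat.cast_sub (by omega), hInt_natCast, eInt_natCast]
    rw [← h1]
    rcases le_total d N with h | h
    · refine (Finset.sum_subset (Finset.range_mono (by omega)) fun k _ hk => ?_).symm
      rw [Finset.mem_range] at hk
      rw [hInt_neg (by omega), mul_zero]
    · refine Finset.sum_subset (Finset.range_mono (by omega)) fun k hk hk' => ?_
      rw [Finset.mem_range] at hk hk'
      rw [eInt_eq_zero_of_lt (by omega), mul_zero, zero_mul]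

/-- The Toeplitz matrix of complete homogeneous symmetric polynomials. -/
def hToeplitz (n L : ℕ) : Matrix (Fin L) (Fin L) (MvPolynomial (Fin n) ℚ) :=
  Matrix.of fun p q => hInt n ((p : ℕ) - (q : ℕ) : ℤ)

/-- The Toeplitz matrix of signed elementary symmetric polynomials. -/
def eToeplitz (n L : ℕ) : Matrix (Fin L) (Fin L) (MvPolynomial (Fin n) ℚ) :=
  Matrix.of fun p q => (-1) ^ ((p : ℕ) + (q : ℕ)) * eInt n ((p : ℕ) - (q : ℕ) : ℤ)

lemma hToeplitz_mul_eToeplitz (n L : ℕ) : hToeplitz n L * eToeplitz n L = 1 := by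
  ext1 p q
  rw [Matrix.mul_apply, Matrix.one_apply]
  simp only [hToeplitz, eToeplitz, Matrix.of_apply]
  rw [Fin.sum_univ_eq_sum_range (fun r => hInt n ((p : ℕ) - r : ℤ) *
    ((-1) ^ (r + (q : ℕ)) * eInt n (r - (q : ℕ) : ℤ))) L]
  obtain ⟨N, hN⟩ : ∃ N, L = q + (N + 1) := ⟨L - q - 1, by omega⟩
  rw [show Finset.range L = Finset.range (q + (N + 1)) from congrArg _ hN,
    Finset.sum_range_add, Finset.sum_eq_zero, zero_add]
  · have := sum_range_eInt_mul_hInt (n := n) (N := N) (z := (p : ℕ) - (q : ℕ)) (by omega)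
    simp only [show (p = q ↔ ((p : ℕ) - (q : ℕ) : ℤ) = 0) by rw [Fin.ext_iff]; omega]
    rw [← this]
    refine Finset.sum_congr rfl fun k _ => ?_
    rw [show ((q : ℕ) + k + (q : ℕ) : ℕ) = 2 * q + k by ring, pow_add, pow_mul]
    push_cast
    rw [show ((q : ℕ) + k - (q : ℕ) : ℤ) = k by ring,
      show ((p : ℕ) - ((q : ℕ) + k) : ℤ) = (p : ℕ) - (q : ℕ) - k by ring]
    ring
  · intro k hk
    rw [Finset.mem_range] at hk
    rw [eInt_neg (by omega)]
    ring

lemma det_hToeplitz (n L : ℕ) : (hToeplitz n L).det = 1 := by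
  rw [Matrix.det_of_isLowerTriangular]
  · simp [hToeplitz]
  · intro p q hpq
    simp only [OrderDual.toDual_lt_toDual] at hpq
    exact hInt_neg (by have : (p : ℕ) < q := hpq; omega)

lemma det_toBlocks₁₁_of_mul_eq_one {ι κ R : Type*} [CommRing R] [Fintype ι] [Fintype κ]
    [DecidableEq ι] [DecidableEq κ] {A B : Matrix (ι ⊕ κ) (ι ⊕ κ) R} (h : A * B = 1) :
    A.toBlocks₁₁.det = A.det * B.toBlocks₂₂.det := by
  have h' := h
  rw [← Matrix.fromBlocks_toBlocks A, ← Matrix.fromBlocks_toBlocks B,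
    Matrix.fromBlocks_multiply, ← Matrix.fromBlocks_one, Matrix.fromBlocks_inj] at h'
  have key : A * Matrix.fromBlocks 1 B.toBlocks₁₂ 0 B.toBlocks₂₂ =
      Matrix.fromBlocks A.toBlocks₁₁ 0 A.toBlocks₂₁ 1 := by
    conv_lhs => rw [← Matrix.fromBlocks_toBlocks A]
    rw [Matrix.fromBlocks_multiply, h'.2.1, h'.2.2.2]
    simp
  have := congrArg Matrix.det key
  rwa [Matrix.det_mul, Matrix.det_fromBlocks_zero₂₁, Matrix.det_fromBlocks_zero₁₂, Matrix.det_one,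
    Matrix.det_one, one_mul, mul_one, eq_comm] at this

lemma sign_eq_prod_of_shuffle {n m : ℕ} (σ : Equiv.Perm (Fin (n + m)))
    (hl : StrictMono fun i => σ (Fin.castAdd m i)) (hr : StrictMono fun j => σ (Fin.natAdd n j)) :
    σ.sign = ∏ j : Fin m, ∏ i : Fin n,
      if σ (Fin.castAdd m i) < σ (Fin.natAdd n j) then 1 else -1 := by
  rw [Equiv.Perm.sign_eq_prod_prod_Iio]
  have h : ∀ j : Fin (n + m), Finset.Iio j = Finset.univ.filter (· < j) := fun j => by ext; simp
  simp_rw [h, Finset.prod_filter, Fin.prod_univ_add]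
  have h1 : ∀ i j : Fin n, (if Fin.castAdd m i < Fin.castAdd m j then
      if σ (Fin.castAdd m i) < σ (Fin.castAdd m j) then (1 : ℤˣ) else -1 else 1) = 1 := by
    intro i j
    split_ifs with h h'
    · rfl
    · exact absurd (hl (show i < j from h)) h'
    · rfl
  have h2 : ∀ i j : Fin m, (if Fin.natAdd n i < Fin.natAdd n j then
      if σ (Fin.natAdd n i) < σ (Fin.natAdd n j) then (1 : ℤˣ) else -1 else 1) = 1 := by
    intro i j
    split_ifs with h h'
    · rfl
    · exact absurd (hr (show i < j by simp only [Fin.lt_def, Fin.val_natAdd] at h ⊢; omega)) h'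
    · rfl
  have h3 : ∀ (i : Fin n) (j : Fin m), Fin.castAdd m i < Fin.natAdd n j := by
    intro i j
    rw [Fin.lt_def, Fin.val_castAdd, Fin.val_natAdd]
    omega
  simp only [h1, h2, h3, (h3 _ _).not_gt, if_true, if_false, Finset.prod_const_one, one_mul,
    mul_one]

/-- The Jacobi-Trudi determinant with one row per variable. -/
def hDet (n : ℕ) (α : Fin n → ℕ) : MvPolynomial (Fin n) ℚ :=
  (Matrix.of fun i j : Fin n => hInt n (α i + (j : ℕ) - (i : ℕ))).det

/-- The dual Jacobi-Trudi determinant of a tuple of column lengths. -/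
def eDet (n : ℕ) {m : ℕ} (c : Fin m → ℕ) : MvPolynomial (Fin n) ℚ :=
  (Matrix.of fun i j : Fin m => eInt n (c i + (j : ℕ) - (i : ℕ))).det

theorem hDet_eq_eDet {n m : ℕ} {α : Fin n → ℕ} {c : Fin m → ℕ} (hα : Antitone α)
    (hc : Antitone c) (hαm : ∀ i, α i ≤ m) (hcn : ∀ j, c j ≤ n)
    (hαc : ∀ (i : Fin n) (j : Fin m), (j : ℕ) < α i ↔ (i : ℕ) < c j) : hDet n α = eDet n c := by
  let r : Fin n → Fin (n + m) := fun i => ⟨i + α i.rev, by have := hαm i.rev; omega⟩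
  let s : Fin m → Fin (n + m) := fun j => ⟨n + j - c j, by omega⟩
  have hr : StrictMono r := by
    intro i j hij
    have : α i.rev ≤ α j.rev := hα (Fin.rev_le_rev.2 hij.le)
    rw [Fin.lt_def] at hij ⊢
    simp only [r]
    omega
  have hs : StrictMono s := by
    intro i j hij
    have := hc hij.le
    have := hcn i
    have := hcn j
    rw [Fin.lt_def] at hij ⊢
    simp only [s]
    omega
  have hrs : ∀ i j, (r i < s j ∧ ¬ (i.rev : ℕ) < c j) ∨ (s j < r i ∧ (i.rev : ℕ) < c j) := by
    intro i j
    have h1 := hαc i.rev j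
    have h2 := Fin.val_rev i
    have := hcn j
    simp only [Fin.lt_def, r, s]
    omega
  have hinj : Function.Injective (Sum.elim r s) :=
    hr.injective.sumElim hs.injective fun i j h => by
      rcases hrs i j with h' | h'
      · exact h'.1.ne h
      · exact h'.1.ne' h
  let e : Fin n ⊕ Fin m ≃ Fin (n + m) := Equiv.ofBijective (Sum.elim r s)
    ((Fintype.bijective_iff_injective_and_card _).2 ⟨hinj, by simp⟩)
  let σ : Equiv.Perm (Fin (n + m)) := finSumFinEquiv.symm.trans e
  have hσl : ∀ i, σ (Fin.castAdd m i) = r i := fun i => by simp [σ, e]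
  have hσr : ∀ j, σ (Fin.natAdd n j) = s j := fun j => by simp [σ, e]
  have hsign : σ.sign = ∏ j : Fin m, (-1) ^ c j := by
    rw [sign_eq_prod_of_shuffle σ (by simpa only [hσl] using hr) (by simpa only [hσr] using hs)]
    refine Finset.prod_congr rfl fun j _ => ?_
    have h1 : ∀ i : Fin n, (if σ (Fin.castAdd m i) < σ (Fin.natAdd n j) then (1 : ℤˣ) else -1) =
        if (i.rev : ℕ) < c j then -1 else 1 := by
      intro i
      rw [hσl, hσr]
      rcases hrs i j with h | h
      · rw [if_pos h.1, if_neg h.2]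
      · rw [if_neg h.1.not_gt, if_pos h.2]
    simp_rw [h1]
    rw [show (∏ i : Fin n, if (i.rev : ℕ) < c j then (-1 : ℤˣ) else 1) =
        ∏ i : Fin n, if (i : ℕ) < c j then (-1 : ℤˣ) else 1 from
          Equiv.prod_comp Fin.revPerm (fun i : Fin n => if (i : ℕ) < c j then (-1 : ℤˣ) else 1),
      Fin.prod_univ_eq_prod_range (fun i => if i < c j then (-1 : ℤˣ) else 1) n,
      ← Finset.prod_filter, Finset.prod_const]
    congr 1
    rw [show (Finset.range n).filter (· < c j) = Finset.range (c j) by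
      ext x; have := hcn j; simp; omega, Finset.card_range]
  have hblock := det_toBlocks₁₁_of_mul_eq_one
    (A := (hToeplitz n (n + m)).submatrix e finSumFinEquiv)
    (B := (eToeplitz n (n + m)).submatrix finSumFinEquiv e) (by
      rw [Matrix.submatrix_mul_equiv, hToeplitz_mul_eToeplitz, Matrix.submatrix_one_equiv])
  have hdet : ((hToeplitz n (n + m)).submatrix e finSumFinEquiv).det =
      ∏ j : Fin m, (-1) ^ c j := by
    have : (hToeplitz n (n + m)).submatrix e finSumFinEquiv =
        ((hToeplitz n (n + m)).submatrix σ id).submatrix finSumFinEquiv finSumFinEquiv := by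
      ext1 p q
      simp [σ]
    rw [this, Matrix.det_submatrix_equiv_self, Matrix.det_permute, det_hToeplitz, hsign]
    simp
  have hA : ((hToeplitz n (n + m)).submatrix e finSumFinEquiv).toBlocks₁₁.det = hDet n α := by
    rw [← Matrix.det_submatrix_equiv_self Fin.revPerm, hDet]
    congr 1
    ext1 i j
    simp only [Matrix.submatrix_apply, Matrix.toBlocks₁₁, Matrix.of_apply, hToeplitz,
      Fin.revPerm_apply, finSumFinEquiv_apply_left]
    congr 1
    have h1 := Fin.val_rev i
    have h2 := Fin.val_rev j
    simp only [e, Equiv.ofBijective_apply, Sum.elim_inl, r, Fin.rev_rev, Fin.val_castAdd]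
    omega
  have hB : ((eToeplitz n (n + m)).submatrix finSumFinEquiv e).toBlocks₂₂.det =
      (∏ j : Fin m, (-1) ^ c j) * eDet n c := by
    have : ((eToeplitz n (n + m)).submatrix finSumFinEquiv e).toBlocks₂₂ =
        Matrix.of fun i j : Fin m => (-1) ^ (i : ℕ) * Matrix.of (fun i j : Fin m =>
          ((-1) ^ (j : ℕ) * (-1) ^ c j) *
            (Matrix.of fun i j : Fin m => eInt n (c i + (j : ℕ) - (i : ℕ))).transpose i j) i j := by
      ext1 i j
      have h1 := hcn j
      simp only [Matrix.submatrix_apply, Matrix.toBlocks₂₂, Matrix.of_apply, eToeplitz,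
        finSumFinEquiv_apply_right, e, Equiv.ofBijective_apply, Sum.elim_inr, s, Fin.val_natAdd,
        Matrix.transpose_apply]
      rw [← mul_assoc, ← pow_add, ← pow_add]
      congr 1
      · obtain ⟨d, hd⟩ : ∃ d, n = c j + d := ⟨n - c j, by omega⟩
        rw [show n + (j : ℕ) - c j = d + j by omega,
          show n + (i : ℕ) + (d + j) = 2 * d + (i + (j + c j)) by omega, pow_add _ (2 * d),
          pow_mul]
        simp
      · congr 1
        omega
    rw [this, Matrix.det_mul_column, Matrix.det_mul_row, Matrix.det_transpose, ← eDet,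
      Finset.prod_mul_distrib, ← mul_assoc, ← mul_assoc, ← Finset.prod_mul_distrib]
    simp [← mul_pow]
  rw [hA, hdet, hB, ← mul_assoc, ← Finset.prod_mul_distrib] at hblock
  rw [hblock]
  simp [← mul_pow]

/-- Adding one to the entries of `α` indexed by `I`. -/
def addIndicator {n : ℕ} (α : Fin n → ℕ) (I : Finset (Fin n)) : Fin n → ℕ :=
  fun i => α i + if i ∈ I then 1 else 0

lemma hDet_eq_zero_of_not_antitone {n : ℕ} {α : Fin n → ℕ}
    (h : ∀ i j, i ≤ j → α j ≤ α i + 1) (hα : ¬ Antitone α) : hDet n α = 0 := by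
  rcases n with _ | n
  · exact absurd (Subsingleton.antitone α) hα
  · rw [Fin.antitone_iff_succ_le] at hα
    push Not at hα
    obtain ⟨i, hi⟩ := hα
    have hi' : α i.succ = α i.castSucc + 1 := le_antisymm (h _ _ (Fin.castSucc_le_succ i)) hi
    refine Matrix.det_zero_of_row_eq (Fin.castSucc_lt_succ (i := i)).ne ?_
    ext1 j
    simp only [Matrix.of_apply]
    congr 1
    rw [hi', Fin.val_castSucc, Fin.val_succ]
    push_cast
    ring

lemma addIndicator_le_add_one {n : ℕ} {α : Fin n → ℕ} (hα : Antitone α) (I : Finset (Fin n))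
    (i j : Fin n) (hij : i ≤ j) : addIndicator α I j ≤ addIndicator α I i + 1 := by
  have := hα hij
  simp only [addIndicator]
  split_ifs <;> omega

/-- The matrix shifting the rows of a Jacobi-Trudi matrix. -/
def shiftMatrix (n : ℕ) : Matrix (Fin n) (Fin n) (MvPolynomial (Fin n) ℚ) :=
  Matrix.of fun i j => if (j : ℕ) + 1 = n then (-1) ^ (n - i - 1) * eInt n (n - (i : ℕ))
    else if (i : ℕ) = j + 1 then 1 else 0

lemma sum_hInt_mul_shiftMatrix {n : ℕ} (p : ℤ) (hp : 0 < p + n) (j : Fin n) :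
    ∑ i : Fin n, hInt n (p + (i : ℕ)) * shiftMatrix n i j = hInt n (p + 1 + (j : ℕ)) := by
  simp only [shiftMatrix, Matrix.of_apply]
  by_cases hj : (j : ℕ) + 1 = n
  · simp only [if_pos hj]
    have key := sum_range_eInt_mul_hInt (n := n) (N := n) (z := p + n) (Or.inr le_rfl)
    rw [if_neg hp.ne', Finset.sum_range_succ', Nat.cast_zero, eInt_zero, sub_zero, pow_zero,
      one_mul, one_mul] at key
    rw [show p + 1 + (j : ℕ) = p + n by omega, ← Equiv.sum_comp Fin.revPerm,
      eq_neg_of_add_eq_zero_right key, ← Finset.sum_neg_distrib,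
      ← Fin.sum_univ_eq_sum_range (fun k => -((-1) ^ (k + 1) * eInt n ((k + 1 : ℕ) : ℤ) *
        hInt n (p + n - ((k + 1 : ℕ) : ℤ)))) n]
    refine Finset.sum_congr rfl fun i _ => ?_
    have hi := Fin.val_rev i
    rw [Fin.revPerm_apply, show n - (i.rev : ℕ) - 1 = i by omega,
      show (n - (i.rev : ℕ) : ℤ) = ((i + 1 : ℕ) : ℤ) by omega,
      show p + (i.rev : ℕ) = p + n - ((i + 1 : ℕ) : ℤ) by omega, pow_succ]
    ring
  · simp only [if_neg hj]
    rw [Finset.sum_eq_single ⟨j + 1, by omega⟩]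
    · rw [if_pos rfl, mul_one]
      congr 1
      push_cast
      ring
    · intro i _ hi
      rw [if_neg fun h => hi (Fin.ext h), mul_zero]
    · simp

lemma sum_hDet_addIndicator_eq_mul (n r : ℕ) (α : Fin n → ℕ) :
    ∑ I ∈ Finset.powersetCard r Finset.univ, hDet n (addIndicator α I) =
      hDet n α *
        ((1 + (Polynomial.X : Polynomial (MvPolynomial (Fin n) ℚ)) •
          (shiftMatrix n).map Polynomial.C).det).coeff r := by
  let V : (Fin n → ℕ) → Matrix (Fin n) (Fin n) (MvPolynomial (Fin n) ℚ) := fun β =>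
    Matrix.of fun i j => hInt n (β i + (j : ℕ) - (i : ℕ))
  have hrow : ∀ I i, i ∈ I → V (addIndicator α I) i = (V α * shiftMatrix n) i := by
    intro I i hi
    ext1 j
    rw [Matrix.mul_apply]
    have := sum_hInt_mul_shiftMatrix (α i - (i : ℕ) : ℤ) (by omega) j
    simp only [V, Matrix.of_apply, addIndicator, if_pos hi]
    rw [show ((α i + 1 : ℕ) + (j : ℕ) - (i : ℕ) : ℤ) = (α i - (i : ℕ) : ℤ) + 1 + (j : ℕ) by
      push_cast; ring, ← this]
    exact Finset.sum_congr rfl fun k _ => by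
      rw [show (α i + (k : ℕ) - (i : ℕ) : ℤ) = α i - (i : ℕ) + (k : ℕ) by ring]
  have hrow' : ∀ I i, i ∉ I → V (addIndicator α I) i = V α i := by
    intro I i hi
    ext1 j
    simp only [V, Matrix.of_apply, addIndicator, if_neg hi, add_zero]
  let A : Fin n → Fin n → Polynomial (MvPolynomial (Fin n) ℚ) :=
    fun i j => Polynomial.X * Polynomial.C ((V α * shiftMatrix n) i j)
  let B : Fin n → Fin n → Polynomial (MvPolynomial (Fin n) ℚ) :=
    fun i j => Polynomial.C (V α i j)
  have hexp : ∀ I : Finset (Fin n), (Matrix.of (I.piecewise A B)).det =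
      Polynomial.C (hDet n (addIndicator α I)) * Polynomial.X ^ I.card := by
    intro I
    have h1 : Matrix.of (I.piecewise A B) =
        Matrix.of fun i j => (if i ∈ I then Polynomial.X else 1) *
          ((V (addIndicator α I)).map Polynomial.C) i j := by
      ext1 i j
      by_cases hi : i ∈ I
      · rw [Matrix.of_apply, Finset.piecewise_eq_of_mem _ _ _ hi, Matrix.of_apply, if_pos hi,
          Matrix.map_apply, hrow I i hi]
      · rw [Matrix.of_apply, Finset.piecewise_eq_of_notMem _ _ _ hi, Matrix.of_apply, if_neg hi,
          Matrix.map_apply, hrow' I i hi, one_mul]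
    rw [h1, Matrix.det_mul_column, Finset.prod_ite_mem, Finset.univ_inter, Finset.prod_const,
      mul_comm]
    congr 1
    exact (RingHom.map_det Polynomial.C _).symm
  have hdet : (Matrix.of (A + B)).det =
      ∑ I : Finset (Fin n), Polynomial.C (hDet n (addIndicator α I)) *
        Polynomial.X ^ I.card := by
    rw [← Finset.sum_congr rfl fun I _ => hexp I]
    exact Matrix.detRowAlternating.toMultilinearMap.map_add_univ A B
  have hfac : Matrix.of (A + B) = Matrix.of B *
      (1 + (Polynomial.X : Polynomial (MvPolynomial (Fin n) ℚ)) •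
        (shiftMatrix n).map Polynomial.C) := by
    rw [show Matrix.of B = (V α).map Polynomial.C from rfl, mul_add, mul_one, Matrix.mul_smul,
      ← Matrix.map_mul, add_comm A B]
    rfl
  rw [hfac, Matrix.det_mul, show (Matrix.of B).det = Polynomial.C (hDet n α) from
    (RingHom.map_det Polynomial.C _).symm] at hdet
  have := congrArg (fun P => Polynomial.coeff P r) hdet
  simp only [Polynomial.coeff_C_mul, Polynomial.finsetSum_coeff, Polynomial.coeff_X_pow] at this
  rw [this, Finset.powersetCard_eq_filter, Finset.sum_filter, Finset.powerset_univ]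
  exact Finset.sum_congr rfl fun I _ => by simp [eq_comm]

lemma hDet_zero (n : ℕ) : hDet n (fun _ => 0) = 1 := by
  rw [hDet_eq_eDet (m := 0) (c := Fin.elim0) (fun _ _ _ => le_rfl) (fun i => i.elim0)
    (fun _ => le_rfl) (fun i => i.elim0) (fun _ j => j.elim0)]
  simp [eDet]

lemma sum_hDet_addIndicator_zero (n r : ℕ) :
    ∑ I ∈ Finset.powersetCard r Finset.univ, hDet n (addIndicator (fun _ => 0) I) =
      eInt n r := by
  rcases lt_or_ge n r with h | h
  · rw [eInt_eq_zero_of_lt (by omega), Finset.powersetCard_eq_empty.2 (by simpa using h),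
      Finset.sum_empty]
  let I₀ : Finset (Fin n) := Finset.univ.filter fun i => (i : ℕ) < r
  have hI₀ : I₀.card = r := by
    rw [Fin.card_filter_val_lt, min_eq_right h]
  rw [Finset.sum_eq_single I₀]
  · rw [hDet_eq_eDet (m := 1) (c := ![r])]
    · simp [eDet]
    · intro i j hij
      rw [Fin.le_def] at hij
      simp only [addIndicator, I₀, Finset.mem_filter, Finset.mem_univ, true_and]
      split_ifs <;> omega
    · exact Subsingleton.antitone _
    · intro i
      simp only [addIndicator]
      split_ifs <;> omega
    · intro j
      fin_cases j
      exact h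
    · intro i j
      fin_cases j
      by_cases hi : (i : ℕ) < r <;> simp [addIndicator, I₀, hi]
  · intro I hI hne
    refine hDet_eq_zero_of_not_antitone (addIndicator_le_add_one (fun _ _ _ => le_rfl) I)
      fun hanti => hne ?_
    rw [Finset.mem_powersetCard_univ] at hI
    by_contra hne'
    obtain ⟨i, hi, hi'⟩ : ∃ i ∈ I, i ∉ I₀ := by
      by_contra! hsub
      exact hne' (Finset.eq_of_subset_of_card_le hsub (by omega))
    have hsub : Finset.Iic i ⊆ I := by
      intro j hj
      have := hanti (Finset.mem_Iic.1 hj)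
      simp only [addIndicator, if_pos hi] at this
      by_contra hjI
      simp [hjI] at this
    have := Finset.card_le_card hsub
    rw [Fin.card_Iic] at this
    simp only [I₀, Finset.mem_filter, Finset.mem_univ, true_and] at hi'
    omega
  · intro hmem
    exact absurd (Finset.mem_powersetCard_univ.2 hI₀) hmem

/-- The dual Pieri rule. -/
theorem eInt_mul_hDet (n r : ℕ) (α : Fin n → ℕ) :
    eInt n r * hDet n α =
      ∑ I ∈ Finset.powersetCard r Finset.univ, hDet n (addIndicator α I) := by
  have h := sum_hDet_addIndicator_eq_mul n r fun _ => 0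
  rw [hDet_zero, one_mul, sum_hDet_addIndicator_zero] at h
  rw [sum_hDet_addIndicator_eq_mul, h, mul_comm]

/-- A sequence symmetric about `s / 2` and decreasing to the right of it. -/
structure SymmUnimodal (f : ℤ → ℕ) (s : ℤ) : Prop where
  symm : ∀ x, f (s - x) = f x
  succ_le : ∀ x, s ≤ 2 * x + 1 → f (x + 1) ≤ f x

lemma SymmUnimodal.le_of_le {f : ℤ → ℕ} {s : ℤ} (hf : SymmUnimodal f s) {x y : ℤ}
    (hx : s ≤ 2 * x + 1) (hxy : x ≤ y) : f y ≤ f x := by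
  induction y, hxy using Int.leInduction with
  | base => rfl
  | succ y hy ih => exact (hf.succ_le y (by omega)).trans ih

lemma SymmUnimodal.sum_range {f : ℤ → ℕ} {s : ℤ} (hf : SymmUnimodal f s) (d : ℕ) :
    SymmUnimodal (fun x => ∑ y ∈ Finset.range (d + 1), f (x - y)) (s + d) where
  symm x := by
    rw [← Finset.sum_range_reflect]
    refine Finset.sum_congr rfl fun y hy => ?_
    rw [Finset.mem_range] at hy
    rw [← hf.symm (x - y)]
    congr 1
    omega
  succ_le x hx := by
    have h : f (x + 1) ≤ f (x - d) := by
      rcases le_or_gt s (2 * (x - d) + 1) with h | h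
      · exact hf.le_of_le h (by omega)
      · rw [← hf.symm (x - d)]
        exact hf.le_of_le (by omega) (by omega)
    have h1 := Finset.sum_range_succ (fun y : ℕ => f (x - y)) d
    have h2 := Finset.sum_range_succ' (fun y : ℕ => f (x + 1 - y)) d
    simp only [Nat.cast_add, Nat.cast_one, Nat.cast_zero, sub_zero, add_sub_add_right_eq_sub] at h2
    rw [h1, h2]
    omega

section FiberLower

variable {ι : Type*} [LinearOrder ι]

lemma exists_initial_of_le_card (F : Finset ι) {y : ℕ} (hy : y ≤ F.card) :
    ∃ L ⊆ F, (∀ i ∈ F, ∀ j ∈ L, i ≤ j → i ∈ L) ∧ L.card = y := by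
  induction F using Finset.induction_on_max with
  | empty => exact ⟨∅, le_rfl, by simp, by simpa [eq_comm] using hy⟩
  | insert a s ha ih =>
    rcases Nat.lt_or_ge s.card y with h | h
    · refine ⟨insert a s, le_rfl, fun i hi _ _ _ => hi, le_antisymm ?_ hy⟩
      exact (Finset.card_insert_le a s).trans h
    · obtain ⟨L, hLs, hL, rfl⟩ := ih h
      refine ⟨L, hLs.trans (Finset.subset_insert a s), fun i hi j hj hij => ?_, rfl⟩
      rcases Finset.mem_insert.1 hi with rfl | hi
      · exact absurd (ha j (hLs hj)) hij.not_gt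
      · exact hL i hi j hj hij

lemma eq_of_initial_of_card_eq {F L L' : Finset ι} (hLF : L ⊆ F) (hLF' : L' ⊆ F)
    (hL : ∀ i ∈ F, ∀ j ∈ L, i ≤ j → i ∈ L) (hL' : ∀ i ∈ F, ∀ j ∈ L', i ≤ j → i ∈ L')
    (h : L.card = L'.card) : L = L' := by
  by_cases hsub : L ⊆ L'
  · exact Finset.eq_of_subset_of_card_le hsub h.ge
  · obtain ⟨j, hj, hj'⟩ := Finset.not_subset.1 hsub
    refine (Finset.eq_of_subset_of_card_le (fun i hi => ?_) h.le).symm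
    rcases le_total i j with hij | hij
    · exact hL i (hLF' hi) j hj hij
    · exact absurd (hL' j (hLF hj) i hi hij) hj'

/-- The subsets of `D` of cardinality `x` that are lower sets within each fiber of `v`. -/
def fiberLower (v : ι → ℕ) (D : Finset ι) (x : ℤ) : Finset (Finset ι) :=
  D.powerset.filter fun K =>
    (∀ i ∈ D, ∀ j ∈ K, i ≤ j → v i = v j → i ∈ K) ∧ (K.card : ℤ) = x

lemma mem_fiberLower {v : ι → ℕ} {D K : Finset ι} {x : ℤ} :
    K ∈ fiberLower v D x ↔
      K ⊆ D ∧ (∀ i ∈ D, ∀ j ∈ K, i ≤ j → v i = v j → i ∈ K) ∧ (K.card : ℤ) = x := by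
  simp [fiberLower]

lemma card_fiberLower_eq_sum (v : ι → ℕ) (D : Finset ι) (c : ℕ) (x : ℤ) :
    (fiberLower v D x).card = ∑ y ∈ Finset.range ((D.filter (v · = c)).card + 1),
      (fiberLower v (D.filter (v · ≠ c)) (x - y)).card := by
  have hmaps : ∀ K ∈ fiberLower v D x,
      (K.filter (v · = c)).card ∈ Finset.range ((D.filter (v · = c)).card + 1) := by
    intro K hK
    rw [Finset.mem_range, Nat.lt_succ_iff]
    exact Finset.card_le_card (Finset.filter_subset_filter _ (mem_fiberLower.1 hK).1)
  rw [Finset.card_eq_sum_card_fiberwise hmaps]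
  refine Finset.sum_congr rfl fun y hy => ?_
  rw [Finset.mem_range, Nat.lt_succ_iff] at hy
  refine Finset.card_bij (fun K _ => K.filter (v · ≠ c)) ?_ ?_ ?_
  · intro K hK
    rw [Finset.mem_filter, mem_fiberLower] at hK
    obtain ⟨⟨hKD, hK, hKx⟩, hKy⟩ := hK
    refine mem_fiberLower.2 ⟨Finset.filter_subset_filter _ hKD, ?_, ?_⟩
    · intro i hi j hj hij hv
      rw [Finset.mem_filter] at hi hj ⊢
      exact ⟨hK i hi.1 j hj.1 hij hv, hi.2⟩
    · have := Finset.card_filter_add_card_filter_not (s := K) (v · = c)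
      simp only [ne_eq]
      omega
  · intro K hK K' hK' h
    rw [Finset.mem_filter, mem_fiberLower] at hK hK'
    obtain ⟨⟨hKD, hK, hKx⟩, hKy⟩ := hK
    obtain ⟨⟨hKD', hK', hKx'⟩, hKy'⟩ := hK'
    have h' : K.filter (v · = c) = K'.filter (v · = c) := by
      refine eq_of_initial_of_card_eq (F := D.filter (v · = c))
        (Finset.filter_subset_filter _ hKD) (Finset.filter_subset_filter _ hKD') ?_ ?_
        (hKy.trans hKy'.symm) <;>
      · intro i hi j hj hij
        rw [Finset.mem_filter] at hi hj ⊢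
        first
        | exact ⟨hK i hi.1 j hj.1 hij (hi.2.trans hj.2.symm), hi.2⟩
        | exact ⟨hK' i hi.1 j hj.1 hij (hi.2.trans hj.2.symm), hi.2⟩
    rw [← Finset.filter_union_filter_not_eq (v · = c) K,
      ← Finset.filter_union_filter_not_eq (v · = c) K', h']
    exact congrArg _ h
  · intro K hK
    rw [mem_fiberLower] at hK
    obtain ⟨hKD, hK, hKx⟩ := hK
    obtain ⟨L, hLF, hL, hLy⟩ := exists_initial_of_le_card _ hy
    have hLc : ∀ i ∈ L, i ∈ D ∧ v i = c := fun i hi => Finset.mem_filter.1 (hLF hi)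
    have hKc : ∀ i ∈ K, i ∈ D ∧ v i ≠ c := fun i hi => Finset.mem_filter.1 (hKD hi)
    have hdisj : Disjoint K L := Finset.disjoint_left.2 fun i hi hi' => (hKc i hi).2 (hLc i hi').2
    refine ⟨K ∪ L, Finset.mem_filter.2 ⟨mem_fiberLower.2 ⟨?_, ?_, ?_⟩, ?_⟩, ?_⟩
    · exact Finset.union_subset (fun i hi => (hKc i hi).1) (fun i hi => (hLc i hi).1)
    · intro i hi j hj hij hv
      rw [Finset.mem_union] at hj ⊢
      rcases hj with hj | hj
      · exact Or.inl (hK i (Finset.mem_filter.2 ⟨hi, hv ▸ (hKc j hj).2⟩) j hj hij hv)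
      · exact Or.inr (hL i (Finset.mem_filter.2 ⟨hi, hv ▸ (hLc j hj).2⟩) j hj hij)
    · rw [Finset.card_union_of_disjoint hdisj]
      push_cast
      omega
    · rw [← hLy]
      congr 1
      ext i
      simp only [Finset.mem_filter, Finset.mem_union]
      constructor
      · rintro ⟨hi | hi, hic⟩
        · exact absurd hic (hKc i hi).2
        · exact hi
      · exact fun hi => ⟨Or.inr hi, (hLc i hi).2⟩
    · ext i
      simp only [Finset.mem_filter, Finset.mem_union]
      constructor
      · rintro ⟨hi | hi, hic⟩
        · exact hi
        · exact absurd (hLc i hi).2 hic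
      · exact fun hi => ⟨Or.inl hi, (hKc i hi).2⟩

lemma symmUnimodal_card_fiberLower (v : ι → ℕ) (D : Finset ι) :
    SymmUnimodal (fun x => (fiberLower v D x).card) D.card := by
  induction D using Finset.strongInduction with
  | H D ih =>
    rcases D.eq_empty_or_nonempty with rfl | ⟨i, hi⟩
    · have h : ∀ x : ℤ, fiberLower v ∅ x = if x = 0 then {∅} else ∅ := by
        intro x
        ext K
        rw [mem_fiberLower]
        split_ifs with hx
        · simp +contextual [hx]
        · simp only [Finset.subset_empty, Finset.notMem_empty, iff_false]
          rintro ⟨rfl, -, h⟩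
          exact hx (by simpa using h.symm)
      constructor
      · intro x
        simp [h]
      · intro x hx
        rw [Finset.card_empty] at hx
        simp only [h]
        rw [if_neg (by omega)]
        simp
    · have hlt : D.filter (v · ≠ v i) ⊂ D :=
        Finset.filter_ssubset.2 ⟨i, hi, by simp⟩
      have := (ih _ hlt).sum_range (D.filter (v · = v i)).card
      simp_rw [← card_fiberLower_eq_sum] at this
      rwa [← Nat.cast_add, add_comm, Finset.card_filter_add_card_filter_not] at this

end FiberLower

lemma addIndicator_inter_union {n : ℕ} (α : Fin n → ℕ) (I J : Finset (Fin n)) :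
    addIndicator (addIndicator α (I ∩ J)) (I ∪ J) = addIndicator (addIndicator α I) J := by
  ext1 i
  simp only [addIndicator, Finset.mem_inter, Finset.mem_union]
  by_cases hi : i ∈ I <;> by_cases hj : i ∈ J <;> simp [hi, hj]

/-- The pairs of vertical strips of sizes `a` and `b` that can be added to `α` successively. -/
def stripPairs {n : ℕ} (α : Fin n → ℕ) (a b : ℕ) : Finset (Finset (Fin n) × Finset (Fin n)) :=
  open scoped Classical in
  (Finset.powersetCard a Finset.univ ×ˢ Finset.powersetCard b Finset.univ).filter fun p =>
    Antitone (addIndicator α p.1) ∧ Antitone (addIndicator (addIndicator α p.1) p.2)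

lemma mem_stripPairs {n : ℕ} {α : Fin n → ℕ} {a b : ℕ} {p : Finset (Fin n) × Finset (Fin n)} :
    p ∈ stripPairs α a b ↔ (p.1.card = a ∧ p.2.card = b) ∧
      Antitone (addIndicator α p.1) ∧ Antitone (addIndicator (addIndicator α p.1) p.2) := by
  simp [stripPairs]

lemma eInt_mul_eInt_mul_hDet {n : ℕ} {α : Fin n → ℕ} (hα : Antitone α) (a b : ℕ) :
    eInt n a * eInt n b * hDet n α =
      ∑ p ∈ stripPairs α a b,
        hDet n (addIndicator (addIndicator α (p.1 ∩ p.2)) (p.1 ∪ p.2)) := by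
  classical
  rw [mul_comm (eInt n a), mul_assoc, eInt_mul_hDet, Finset.mul_sum, stripPairs,
    Finset.sum_filter, Finset.sum_product]
  refine Finset.sum_congr rfl fun I _ => ?_
  by_cases hI : Antitone (addIndicator α I)
  · rw [eInt_mul_hDet]
    refine Finset.sum_congr rfl fun J _ => ?_
    rw [addIndicator_inter_union]
    split_ifs with hJ
    · rfl
    · exact hDet_eq_zero_of_not_antitone (addIndicator_le_add_one hI J) fun h => hJ ⟨hI, h⟩
  · rw [hDet_eq_zero_of_not_antitone (addIndicator_le_add_one hα I) hI, mul_zero]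
    exact (Finset.sum_eq_zero fun J _ => if_neg fun h => hI h.1).symm

lemma antitone_addIndicator_union_iff {n : ℕ} {α : Fin n → ℕ} (hα : Antitone α)
    {A B K : Finset (Fin n)} (hAB : A ⊆ B) (hB : Antitone (addIndicator (addIndicator α A) B))
    (hK : K ⊆ B \ A) : Antitone (addIndicator α (A ∪ K)) ↔
      ∀ i ∈ B \ A, ∀ j ∈ K, i ≤ j → α i = α j → i ∈ K := by
  constructor
  · intro h i hi j hj hij hv
    have := h hij
    simp only [addIndicator, Finset.mem_union, hj, or_true, if_true] at this
    rw [Finset.mem_sdiff] at hi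
    by_contra hiK
    simp [hi.2, hiK] at this
    omega
  · intro h i j hij
    rcases (hα hij).lt_or_eq with hlt | heq
    · simp only [addIndicator]
      split_ifs <;> omega
    · have himp : j ∈ A ∪ K → i ∈ A ∪ K := by
        intro hj
        have hBij := hB hij
        simp only [addIndicator, heq] at hBij
        by_contra hi
        rw [Finset.mem_union, not_or] at hi
        rcases Finset.mem_union.1 hj with hj | hj
        · simp only [hj, hAB hj, hi.1, if_true, if_false] at hBij
          split_ifs at hBij <;> omega
        · have hjB := Finset.mem_sdiff.1 (hK hj)
          simp only [hjB.1, hjB.2, hi.1, if_true, if_false] at hBij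
          have hiB : i ∈ B := by
            by_contra hiB
            simp only [hiB, if_false] at hBij
            omega
          exact hi.2 (h i (Finset.mem_sdiff.2 ⟨hiB, hi.1⟩) j hj hij heq.symm)
      simp only [addIndicator, heq]
      by_cases hj : j ∈ A ∪ K
      · rw [if_pos hj, if_pos (himp hj)]
      · rw [if_neg hj]
        omega

lemma card_stripPairs_filter {n : ℕ} {α : Fin n → ℕ} (hα : Antitone α) {A B : Finset (Fin n)}
    (hAB : A ⊆ B) (hB : Antitone (addIndicator (addIndicator α A) B)) {a b : ℕ}
    (hab : a + b = A.card + B.card) :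
    ((stripPairs α a b).filter fun p => (p.1 ∩ p.2, p.1 ∪ p.2) = (A, B)).card =
      (fiberLower α (B \ A) (a - A.card)).card := by
  refine Finset.card_bij' (fun p _ => p.1 \ A) (fun K _ => (A ∪ K, B \ K)) ?_ ?_ ?_ ?_
  · rintro ⟨I, J⟩ hp
    rw [Finset.mem_filter, mem_stripPairs, Prod.mk.injEq] at hp
    obtain ⟨⟨⟨rfl, rfl⟩, hI, -⟩, rfl, rfl⟩ := hp
    dsimp only at *
    have hsub : I \ (I ∩ J) ⊆ (I ∪ J) \ (I ∩ J) :=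
      Finset.sdiff_subset_sdiff Finset.subset_union_left le_rfl
    rw [mem_fiberLower, ← antitone_addIndicator_union_iff hα hAB hB hsub,
      Finset.union_sdiff_of_subset Finset.inter_subset_left]
    refine ⟨hsub, hI, ?_⟩
    rw [Finset.card_sdiff_of_subset Finset.inter_subset_left,
      Nat.cast_sub (Finset.card_le_card Finset.inter_subset_left)]
  · intro K hK
    rw [mem_fiberLower] at hK
    obtain ⟨hKB, hK, hKa⟩ := hK
    rw [← antitone_addIndicator_union_iff hα hAB hB hKB] at hK
    have hKB' : K ⊆ B := hKB.trans Finset.sdiff_subset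
    have hdisj : Disjoint A K := Finset.disjoint_right.2 fun i hi => (Finset.mem_sdiff.1 (hKB hi)).2
    have h1 : (A ∪ K) ∩ (B \ K) = A := by
      ext i
      have := @hAB i
      have : i ∈ A → i ∉ K := fun h => Finset.disjoint_left.1 hdisj h
      simp only [Finset.mem_inter, Finset.mem_union, Finset.mem_sdiff]
      tauto
    have h2 : (A ∪ K) ∪ (B \ K) = B := by
      ext i
      have := @hAB i
      have := @hKB' i
      simp only [Finset.mem_union, Finset.mem_sdiff]
      tauto
    rw [Finset.mem_filter, mem_stripPairs]
    refine ⟨⟨⟨?_, ?_⟩, hK, ?_⟩, ?_⟩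
    · rw [Finset.card_union_of_disjoint hdisj]
      omega
    · rw [Finset.card_sdiff_of_subset hKB']
      have := Finset.card_le_card hKB'
      omega
    · rw [← addIndicator_inter_union, h1, h2]
      exact hB
    · rw [h1, h2]
  · rintro ⟨I, J⟩ hp
    rw [Finset.mem_filter, Prod.mk.injEq] at hp
    obtain ⟨-, rfl, rfl⟩ := hp
    ext i
    · simp
      tauto
    · simp
      tauto
  · intro K hK
    rw [mem_fiberLower] at hK
    ext i
    have := @hK.1 i
    simp only [Finset.mem_union, Finset.mem_sdiff] at this ⊢
    tauto

/-- The cone spanned by the Jacobi-Trudi determinants of partitions. -/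
def schurCone (n : ℕ) : Submodule ℚ≥0 (MvPolynomial (Fin n) ℚ) :=
  Submodule.span ℚ≥0 {f | ∃ α, Antitone α ∧ hDet n α = f}

lemma hDet_mem_schurCone {n : ℕ} {α : Fin n → ℕ} (hα : Antitone α) : hDet n α ∈ schurCone n :=
  Submodule.subset_span ⟨α, hα, rfl⟩

lemma sum_sub_sum_mem_of_card_le {ι κ M : Type*} [AddCommGroup M] [Fintype κ] [DecidableEq κ]
    (S : AddSubmonoid M) (s t : Finset ι) (g : ι → κ) (F : κ → M)
    (hF : ∀ i ∈ s, F (g i) ∈ S)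
    (h : ∀ y, (t.filter (g · = y)).card ≤ (s.filter (g · = y)).card) :
    ∑ i ∈ s, F (g i) - ∑ i ∈ t, F (g i) ∈ S := by
  have key : ∀ u : Finset ι, ∑ i ∈ u, F (g i) = ∑ y, (u.filter (g · = y)).card • F y := by
    intro u
    rw [← Finset.sum_fiberwise u g]
    refine Finset.sum_congr rfl fun y _ => ?_
    rw [← Finset.sum_const]
    exact Finset.sum_congr rfl fun i hi => by rw [(Finset.mem_filter.1 hi).2]
  rw [key, key, ← Finset.sum_sub_distrib]
  refine sum_mem fun y _ => ?_
  rw [sub_eq_add_neg, ← sub_nsmul _ (h y)]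
  rcases (s.filter (g · = y)).eq_empty_or_nonempty with h' | ⟨i, hi⟩
  · rw [h', Finset.card_empty, Nat.zero_sub, zero_nsmul]
    exact zero_mem S
  · rw [Finset.mem_filter] at hi
    exact nsmul_mem (hi.2 ▸ hF i hi.1) _

lemma two_row_mul_hDet_mem_schurCone {n : ℕ} {α : Fin n → ℕ} (hα : Antitone α) {a b : ℕ}
    (hab : b + 1 ≤ a) :
    (eInt n a * eInt n (b + 1 : ℕ) - eInt n (a + 1 : ℕ) * eInt n b) * hDet n α ∈ schurCone n := by
  rw [sub_mul, eInt_mul_eInt_mul_hDet hα, eInt_mul_eInt_mul_hDet hα]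
  refine sum_sub_sum_mem_of_card_le (schurCone n).toAddSubmonoid _ _
    (fun p : Finset (Fin n) × Finset (Fin n) => (p.1 ∩ p.2, p.1 ∪ p.2))
    (fun q => hDet n (addIndicator (addIndicator α q.1) q.2)) ?_ ?_
  · intro p hp
    rw [mem_stripPairs] at hp
    refine hDet_mem_schurCone ?_
    rw [addIndicator_inter_union]
    exact hp.2.2
  · rintro ⟨A, B⟩
    rcases Finset.eq_empty_or_nonempty
      ((stripPairs α (a + 1) b).filter fun p => (p.1 ∩ p.2, p.1 ∪ p.2) = (A, B)) with h | ⟨p, hp⟩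
    · rw [h]
      simp
    · rw [Finset.mem_filter, mem_stripPairs, Prod.mk.injEq] at hp
      obtain ⟨⟨⟨hp1, hp2⟩, -, hp3⟩, rfl, rfl⟩ := hp
      have hsub : p.1 ∩ p.2 ⊆ p.1 ∪ p.2 :=
        Finset.inter_subset_left.trans Finset.subset_union_left
      have hcard := Finset.card_inter_add_card_union p.1 p.2
      rw [← addIndicator_inter_union] at hp3
      rw [card_stripPairs_filter hα hsub hp3 (by omega),
        card_stripPairs_filter hα hsub hp3 (by omega)]
      have := (symmUnimodal_card_fiberLower α ((p.1 ∪ p.2) \ (p.1 ∩ p.2))).succ_le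
        (a - (p.1 ∩ p.2).card) (by
          rw [Finset.card_sdiff_of_subset hsub, Nat.cast_sub (Finset.card_le_card hsub)]
          omega)
      refine le_of_eq_of_le ?_ this
      congr 2
      push_cast
      ring

lemma eDet_mem_schurCone {n m : ℕ} {c : Fin m → ℕ} (hc : Antitone c) :
    eDet n c ∈ schurCone n := by
  by_cases hcn : ∀ j, c j ≤ n
  · let α : Fin n → ℕ := fun i => (Finset.univ.filter fun j => (i : ℕ) < c j).card
    have hα : Antitone α := fun i i' hii' => Finset.card_le_card fun j hj => by
      simp only [Finset.mem_filter, Finset.mem_univ, true_and] at hj ⊢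
      exact lt_of_le_of_lt hii' hj
    rw [← hDet_eq_eDet (α := α) hα hc (fun i => ?_) hcn (fun i j => ?_)]
    · exact hDet_mem_schurCone hα
    · exact (Finset.card_le_univ _).trans_eq (Fintype.card_fin m)
    · constructor
      · intro h
        by_contra hij
        have hsub : (Finset.univ.filter fun j => (i : ℕ) < c j) ⊆ Finset.Iio j := by
          intro j' hj'
          rw [Finset.mem_filter] at hj'
          rw [Finset.mem_Iio]
          by_contra hjj'
          exact hij (hj'.2.trans_le (hc (not_lt.1 hjj')))
        have := Finset.card_le_card hsub
        rw [Fin.card_Iio] at this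
        exact absurd h this.not_gt
      · intro h
        have hsub : Finset.Iic j ⊆ Finset.univ.filter fun j => (i : ℕ) < c j := by
          intro j' hj'
          exact Finset.mem_filter.2 ⟨Finset.mem_univ _, h.trans_le (hc (Finset.mem_Iic.1 hj'))⟩
        have := Finset.card_le_card hsub
        rw [Fin.card_Iic] at this
        exact this
  · push Not at hcn
    obtain ⟨j, hj⟩ := hcn
    have h0 : n < c ⟨0, j.pos⟩ := hj.trans_le (hc (Fin.mk_le_of_le_val (Nat.zero_le _)))
    rw [eDet, Matrix.det_eq_zero_of_row_eq_zero ⟨0, j.pos⟩ fun j' => ?_]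
    · exact zero_mem _
    · rw [Matrix.of_apply, eInt_eq_zero_of_lt]
      push_cast
      omega

lemma eDet_two (n a b : ℕ) :
    eDet n ![a, b] = eInt n a * eInt n b - eInt n (a + 1) * eInt n (b - 1) := by
  simp [eDet, Matrix.det_fin_two]

lemma eDet_two_mul_mem_schurCone {n a b : ℕ} (hab : b ≤ a) {f : MvPolynomial (Fin n) ℚ}
    (hf : f ∈ schurCone n) : eDet n ![a, b] * f ∈ schurCone n := by
  induction hf using Submodule.span_induction with
  | mem f hf =>
    obtain ⟨α, hα, rfl⟩ := hf
    rw [eDet_two]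
    rcases b with _ | b
    · rw [eInt_neg (k := ((0 : ℕ) : ℤ) - 1) (by simp), Nat.cast_zero, eInt_zero, mul_one, mul_zero,
        sub_zero, eInt_mul_hDet]
      refine sum_mem fun I _ => ?_
      by_cases hI : Antitone (addIndicator α I)
      · exact hDet_mem_schurCone hI
      · rw [hDet_eq_zero_of_not_antitone (addIndicator_le_add_one hα I) hI]
        exact zero_mem _
    · convert two_row_mul_hDet_mem_schurCone hα hab using 5
      · simp
      · push_cast
        ring
  | zero =>
    rw [mul_zero]
    exact zero_mem _
  | add f g _ _ hf hg =>
    rw [mul_add]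
    exact add_mem hf hg
  | smul q f _ hf =>
    rw [mul_smul_comm]
    exact Submodule.smul_mem _ q hf

lemma schur_eq_hDet {n : ℕ} {lam : ℕ → ℕ} (hlam : Antitone lam) (hn : lam n = 0) :
    schur n lam = hDet n fun i => lam i := by
  have hL : partLen lam ≤ n := Nat.sInf_le hn
  have hL0 : ∀ i, partLen lam ≤ i → lam i = 0 := fun i hi =>
    Nat.le_zero.1 ((hlam hi).trans_eq (Nat.sInf_mem (⟨n, hn⟩ : {N | lam N = 0}.Nonempty)))
  rw [hDet, Matrix.twoBlockTriangular_det _ fun i : Fin n => (i : ℕ) < partLen lam]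
  · have h2 : (Matrix.toSquareBlockProp (Matrix.of fun i j : Fin n =>
        hInt n (lam i + (j : ℕ) - (i : ℕ))) fun i => ¬ (i : ℕ) < partLen lam).det = 1 := by
      rw [Matrix.det_of_isUpperTriangular]
      · refine Finset.prod_eq_one fun i _ => ?_
        rw [Matrix.toSquareBlockProp_def, Matrix.of_apply, Matrix.of_apply,
          hL0 _ (not_lt.1 i.2)]
        simp
      · intro i j hij
        have hij' : ((j : Fin n) : ℕ) < (i : Fin n) := hij
        rw [Matrix.toSquareBlockProp_def, Matrix.of_apply, Matrix.of_apply, hInt_neg]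
        rw [hL0 _ (not_lt.1 i.2)]
        omega
    rw [h2, mul_one, schur, ← Matrix.det_submatrix_equiv_self (Fin.castLEOrderIso hL).toEquiv]
    rfl
  · intro i hi j hj
    rw [Matrix.of_apply, hL0 i (not_lt.1 hi), hInt_neg]
    omega

lemma schurPositive_of_mem_schurCone {n : ℕ} {f : MvPolynomial (Fin n) ℚ}
    (hf : f ∈ schurCone n) : SchurPositive n f := by
  have hle : schurCone n ≤ Submodule.span ℚ≥0 (schur n '' {lam | IsPartition lam}) := by
    refine Submodule.span_mono ?_
    rintro _ ⟨α, hα, rfl⟩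
    let lam : ℕ → ℕ := fun i => if h : i < n then α ⟨i, h⟩ else 0
    have hlam : Antitone lam := by
      intro i j hij
      simp only [lam]
      split_ifs with h h'
      · exact hα hij
      · omega
      · exact Nat.zero_le _
      · rfl
    refine ⟨lam, ⟨hlam, n, fun i hi => dif_neg hi.not_gt⟩, ?_⟩
    rw [schur_eq_hDet hlam (dif_neg (lt_irrefl n))]
    congr 1
    ext1 i
    exact dif_pos i.2
  obtain ⟨l, hl, rfl⟩ := (Finsupp.mem_span_image_iff_linearCombination _).1 (hle hf)
  exact ⟨l.support, fun μ => l μ, fun μ hμ => hl hμ, fun μ _ => (l μ).2,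
    Finsupp.linearCombination_apply _ _⟩

/-- The substitution `X j ↦ X j + t`. -/
def shiftVars (n : ℕ) : MvPolynomial (Fin n) ℚ →ₐ[ℚ] Polynomial (MvPolynomial (Fin n) ℚ) :=
  MvPolynomial.aeval fun j => Polynomial.C (X j) + Polynomial.X

lemma shiftVars_eInt_natCast {n j : ℕ} (hj : j ≤ n) :
    shiftVars n (eInt n j) = Polynomial.hasseDeriv (n - j)
      ((Finset.univ.val.map fun i : Fin n => (X i : MvPolynomial (Fin n) ℚ)).map
        fun r => Polynomial.X + Polynomial.C r).prod := by
  rw [eInt_natCast, shiftVars, aeval_esymm_eq_multiset_esymm]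
  set M : Multiset (Polynomial (MvPolynomial (Fin n) ℚ)) :=
    Finset.univ.val.map fun j => Polynomial.C (X j) + Polynomial.X with hM
  have hcard : M.card = n := by simp [hM]
  have h := Multiset.prod_X_add_C_coeff M (k := n - j) (by omega)
  rw [hcard, Nat.sub_sub_self hj] at h
  rw [← h]
  set Q := ((Finset.univ.val.map fun i : Fin n => (X i : MvPolynomial (Fin n) ℚ)).map
        fun r => Polynomial.X + Polynomial.C r).prod with hQ
  have hT : (M.map fun r => Polynomial.X + Polynomial.C r).prod =
      Polynomial.taylor Polynomial.X (Q.map Polynomial.C) := by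
    rw [hQ, Polynomial.map_multiset_prod, ← Polynomial.taylorAlgHom_apply,
      map_multiset_prod, hM]
    simp only [Multiset.map_map]
    congr 1
    refine Multiset.map_congr rfl fun i _ => ?_
    simp
    ring
  have hder : Polynomial.hasseDeriv (n - j) (Q.map Polynomial.C) =
      (Polynomial.hasseDeriv (n - j) Q).map Polynomial.C := by
    ext1 i
    simp [Polynomial.hasseDeriv_coeff]
  rw [hT, Polynomial.taylor_coeff, hder, Polynomial.eval_map, Polynomial.eval₂_C_X]

lemma coeff_shiftVars_eInt_natCast {n j : ℕ} (hj : j ≤ n) (i : ℕ) :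
    (shiftVars n (eInt n j)).coeff i = ((i + (n - j)).choose (n - j) : ℕ) * eInt n (j - i) := by
  rw [shiftVars_eInt_natCast hj, Polynomial.hasseDeriv_coeff]
  congr 1
  rcases le_or_gt i j with h | h
  · rw [Multiset.prod_X_add_C_coeff _ (by simp; omega), Multiset.card_map,
      Finset.card_val, Finset.card_univ, Fintype.card_fin, ← Nat.cast_sub h, eInt_natCast,
      show n - (i + (n - j)) = j - i by omega, esymm_eq_multiset_esymm]
  · rw [eInt_neg (by omega)]
    refine Polynomial.coeff_eq_zero_of_natDegree_lt
      ((Polynomial.natDegree_multiset_prod_le _).trans_lt ?_)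
    simp only [Multiset.map_map, Function.comp_def, Polynomial.natDegree_X_add_C]
    simp
    omega

lemma coeff_zero_shiftVars_eInt (n : ℕ) (z : ℤ) :
    (shiftVars n (eInt n z)).coeff 0 = eInt n z := by
  rcases lt_or_ge z 0 with h | h
  · simp [eInt_neg h]
  lift z to ℕ using h
  rcases le_or_gt z n with h | h
  · rw [coeff_shiftVars_eInt_natCast h]
    simp
  · simp [eInt_eq_zero_of_lt (Nat.cast_lt.2 h)]

lemma coeff_one_shiftVars_eInt (n : ℕ) (z : ℤ) :
    (shiftVars n (eInt n z)).coeff 1 = ((n - z + 1 : ℤ) : MvPolynomial (Fin n) ℚ) *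
      eInt n (z - 1) := by
  rcases lt_or_ge z 0 with h | h
  · simp [eInt_neg h, eInt_neg (show z - 1 < 0 by omega)]
  lift z to ℕ using h
  rcases le_or_gt z n with h | h
  · obtain ⟨d, rfl⟩ := Nat.exists_eq_add_of_le h
    rw [coeff_shiftVars_eInt_natCast h, Nat.add_sub_cancel_left, Nat.add_comm 1,
      Nat.choose_succ_self_right]
    push_cast
    ring_nf
  · rw [eInt_eq_zero_of_lt (Nat.cast_lt.2 h)]
    rcases Nat.lt_or_ge (n + 1) z with h' | h'
    · simp [eInt_eq_zero_of_lt (show (n : ℤ) < z - 1 by omega)]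
    · rw [show (n - z + 1 : ℤ) = 0 by omega]
      simp

lemma two_mul_coeff_two_shiftVars_eInt (n : ℕ) (z : ℤ) :
    2 * (shiftVars n (eInt n z)).coeff 2 =
      ((n - z + 1 : ℤ) : MvPolynomial (Fin n) ℚ) * ((n - z + 2 : ℤ) : MvPolynomial (Fin n) ℚ) *
      eInt n (z - 2) := by
  rcases lt_or_ge z 0 with h | h
  · simp [eInt_neg h, eInt_neg (show z - 2 < 0 by omega)]
  lift z to ℕ using h
  rcases le_or_gt z n with h | h
  · obtain ⟨d, rfl⟩ := Nat.exists_eq_add_of_le h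
    have h2 : 2 * ((2 + d).choose d) = (d + 1) * (d + 2) := by
      have := Nat.add_one_mul_choose_eq (d + 1) 1
      rw [Nat.choose_one_right] at this
      rw [add_comm 2 d, Nat.choose_symm_add]
      linarith
    rw [coeff_shiftVars_eInt_natCast h, Nat.add_sub_cancel_left, ← mul_assoc]
    have h3 := congrArg (Nat.cast (R := MvPolynomial (Fin (z + d)) ℚ)) h2
    push_cast at h3 ⊢
    rw [h3]
    ring_nf
  · rw [eInt_eq_zero_of_lt (Nat.cast_lt.2 h)]
    rcases Nat.lt_or_ge (n + 2) z with h' | h'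
    · simp [eInt_eq_zero_of_lt (show (n : ℤ) < z - 2 by omega)]
    · have : (n - z + 1 : ℤ) = 0 ∨ (n - z + 2 : ℤ) = 0 := by omega
      rcases this with h0 | h0 <;> simp [h0]

lemma eDet_three (n a b c : ℕ) :
    eDet n ![a, b, c] =
      eInt n a * (eInt n b * eInt n c - eInt n (b + 1) * eInt n (c - 1)) -
      eInt n (a + 1) * (eInt n (b - 1) * eInt n c - eInt n (b + 1) * eInt n (c - 2)) +
      eInt n (a + 2) * (eInt n (b - 1) * eInt n (c - 1) - eInt n b * eInt n (c - 2)) := by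
  rw [eDet, Matrix.det_fin_three]
  simp only [Matrix.of_apply, Matrix.cons_val, Fin.isValue, Fin.val_zero, Fin.val_one,
    Fin.val_two, Nat.cast_zero, Nat.cast_one, Nat.cast_ofNat, add_zero, sub_zero,
    add_sub_cancel_right, show ∀ z : ℤ, z + 1 - 2 = z - 1 by intro z; ring,
    show ∀ z : ℤ, z + 2 - 1 = z + 1 by intro z; ring]
  ring

lemma eDet_four_one (n a b c : ℕ) :
    eDet n ![a, b, c, 1] = eDet n ![a, b, c] * eInt n 1 -
      (eInt n a * (eInt n b * eInt n (c + 1) - eInt n (b + 2) * eInt n (c - 1)) -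
      eInt n (a + 1) * (eInt n (b - 1) * eInt n (c + 1) - eInt n (b + 2) * eInt n (c - 2)) +
      eInt n (a + 3) * (eInt n (b - 1) * eInt n (c - 1) - eInt n b * eInt n (c - 2))) := by
  rw [eDet_three, eDet, Matrix.det_succ_row _ 3]
  simp only [Fin.sum_univ_four, Matrix.det_fin_three, Fin.succAbove, Matrix.submatrix_apply,
    Matrix.of_apply]
  simp
  rw [eInt_neg (k := -1) (by norm_num), eInt_neg (k := -2) (by norm_num)]
  ring_nf

lemma derived_eq_coeff_shiftVars (n i : ℕ) (p : MvPolynomial (Fin n) ℚ) :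
    derived n i p = (shiftVars n p).coeff i := rfl

lemma coeff_two_mul {R : Type*} [CommRing R] (p q : Polynomial R) :
    (p * q).coeff 2 = p.coeff 0 * q.coeff 2 + p.coeff 1 * q.coeff 1 + p.coeff 2 * q.coeff 0 := by
  rw [Polynomial.coeff_mul, Finset.Nat.sum_antidiagonal_eq_sum_range_succ_mk]
  simp [Finset.sum_range_succ]

lemma eDet_columns_eq (n K : ℕ) :
    eDet n ![K + 2, K + 2, 1] =
      eInt n 1 * (eInt n (K + 2) * eInt n (K + 2) - eInt n (K + 3) * eInt n (K + 1)) -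
        (eInt n (K + 2) * eInt n (K + 3) - eInt n (K + 4) * eInt n (K + 1)) := by
  rw [eDet_three]
  simp only [Nat.cast_add, Nat.cast_one, Nat.cast_ofNat]
  rw [show (1 : ℤ) - 1 = 0 by norm_num, eInt_zero, eInt_neg (show (1 : ℤ) - 2 < 0 by norm_num)]
  ring_nf

lemma derived_one_eDet {n K m : ℕ} (hn : n = K + 2 + m) :
    derived n 1 (eDet n ![K + 2, K + 2, 1]) =
      ((K : MvPolynomial (Fin n) ℚ) + m + 4) * eDet n ![K + 2, K + 2] +
        (m + 2) * eDet n ![K + 2, K + 1, 1] := by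
  rw [derived_eq_coeff_shiftVars, eDet_columns_eq]
  simp only [map_sub, map_mul, Polynomial.coeff_sub, Polynomial.mul_coeff_one,
    coeff_zero_shiftVars_eInt, coeff_one_shiftVars_eInt, Polynomial.mul_coeff_zero]
  rw [eDet_two, eDet_three, hn]
  simp only [Nat.cast_add, Nat.cast_one, Nat.cast_ofNat]
  rw [show (1 : ℤ) - 1 = 0 by norm_num, eInt_zero, eInt_neg (show (1 : ℤ) - 2 < 0 by norm_num)]
  push_cast
  ring_nf

lemma two_mul_derived_two_eDet {n K m : ℕ} (hn : n = K + 2 + m) :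
    2 * derived n 2 (eDet n ![K + 2, K + 2, 1]) =
      2 * ((K : MvPolynomial (Fin n) ℚ) + m + 4) * (m + 2) * eDet n ![K + 2, K + 1] +
        (m + 2) * (m + 3) * eDet n ![K + 2, K, 1] +
        (m + 2) * (m + 1) * eDet n ![K + 1, K + 1, 1] := by
  have h0 := two_mul_coeff_two_shiftVars_eInt n 1
  have h1 := two_mul_coeff_two_shiftVars_eInt n (K + 1)
  have h2 := two_mul_coeff_two_shiftVars_eInt n (K + 2)
  have h3 := two_mul_coeff_two_shiftVars_eInt n (K + 3)
  have h4 := two_mul_coeff_two_shiftVars_eInt n (K + 4)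
  rw [derived_eq_coeff_shiftVars, eDet_columns_eq]
  simp only [map_sub, map_mul, Polynomial.coeff_sub, coeff_two_mul, Polynomial.mul_coeff_one,
    coeff_zero_shiftVars_eInt, coeff_one_shiftVars_eInt, Polynomial.mul_coeff_zero]
  rw [eDet_two, eDet_three, eDet_three]
  simp only [Nat.cast_add, Nat.cast_one, Nat.cast_ofNat]
  rw [show (1 : ℤ) - 1 = 0 by norm_num, eInt_zero, eInt_neg (show (1 : ℤ) - 2 < 0 by norm_num)]
  rw [eInt_neg (show (1 : ℤ) - 2 < 0 by norm_num)] at h0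
  have hn' : (n : MvPolynomial (Fin n) ℚ) = K + 2 + m := by exact_mod_cast congrArg Nat.cast hn
  push_cast at h0 h1 h2 h3 h4 ⊢
  rw [hn'] at h0 h1 h2 h3 h4 ⊢
  linear_combination (norm := ring_nf)
    (eInt n (K + 2) * eInt n (K + 2) - eInt n (K + 3) * eInt n (K + 1)) * h0 +
    (eInt n (K + 4) - eInt n 1 * eInt n (K + 3)) * h1 +
    (2 * eInt n 1 * eInt n (K + 2) - eInt n (K + 3)) * h2 -
    (eInt n 1 * eInt n (K + 1) + eInt n (K + 2)) * h3 + eInt n (K + 1) * h4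

lemma eDet_columns_mul_eDet_two (n K : ℕ) :
    eDet n ![K + 2, K + 2, 1] * eDet n ![K + 2, K + 1] =
      eDet n ![K + 2, K + 2] * eDet n ![K + 2, K + 1, 1] + eDet n ![K + 2, K + 2] ^ 2 -
        eDet n ![K + 3, K + 3] * eDet n ![K + 1, K + 1] := by
  simp only [eDet_two, eDet_three, Nat.cast_add, Nat.cast_one, Nat.cast_ofNat,
    sub_self, eInt_zero, eInt_neg (show (1 : ℤ) - 2 < 0 by norm_num)]
  ring_nf

lemma eDet_sq_sub_eDet_columns_mul₁ (n K : ℕ) :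
    eDet n ![K + 2, K + 1, 1] ^ 2 - eDet n ![K + 2, K + 2, 1] * eDet n ![K + 2, K, 1] =
      eDet n ![K + 1, K + 1] * eDet n ![K + 2, K + 2, 2] +
        eDet n ![K + 2, K + 2] * eDet n ![K + 1, K + 1, 1, 1] +
        eDet n ![K + 3, 1] * eDet n ![K + 1, K + 1, K + 1, 1] +
        eDet n ![K + 2, K + 2] ^ 2 - eDet n ![K + 3, K + 3] * eDet n ![K + 1, K + 1] := by
  simp only [eDet_two, eDet_three, eDet_four_one, Nat.cast_add, Nat.cast_one, Nat.cast_ofNat,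
    sub_self, eInt_zero, eInt_neg (show (1 : ℤ) - 2 < 0 by norm_num)]
  ring_nf

lemma eDet_sq_sub_eDet_columns_mul₂ (n K : ℕ) :
    eDet n ![K + 2, K + 1, 1] ^ 2 - eDet n ![K + 2, K + 2, 1] * eDet n ![K + 1, K + 1, 1] =
      eDet n ![K, 1] * eDet n ![K + 2, K + 2, K + 2, 1] +
        eDet n ![K + 1, K + 1] * eDet n ![K + 3, K + 1, 2] +
        eDet n ![K + 3, K + 1] * eDet n ![K + 1, K + 1, 1, 1] +
        eDet n ![K + 2, K + 2] ^ 2 - eDet n ![K + 3, K + 3] * eDet n ![K + 1, K + 1] := by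
  simp only [eDet_two, eDet_three, eDet_four_one, Nat.cast_add, Nat.cast_one, Nat.cast_ofNat,
    sub_self, eInt_zero, eInt_neg (show (1 : ℤ) - 2 < 0 by norm_num)]
  ring_nf

lemma schur_eq_eDet {n K : ℕ} (hn : K + 2 ≤ n) (hK : 1 ≤ K) :
    schur n (fun i => if i = 0 then 3 else if i < K + 2 then 2 else 0) =
      eDet n ![K + 2, K + 2, 1] := by
  have hanti : Antitone fun i : ℕ => if i = 0 then 3 else if i < K + 2 then 2 else 0 := by
    intro i j hij
    dsimp only
    split_ifs <;> omega
  rw [schur_eq_hDet hanti (by split_ifs <;> omega)]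
  refine hDet_eq_eDet (fun i j hij => hanti (show (i : ℕ) ≤ j from hij)) ?_ ?_ ?_ ?_
  · simp [Fin.antitone_iff_succ_le, Fin.forall_fin_succ]
  · intro i
    split_ifs <;> omega
  · simp [Fin.forall_fin_succ]
    omega
  · intro i j
    fin_cases j <;> simp <;> split_ifs <;> omega

lemma two_mul_derived_sq_sub_mem_schurCone {n K m : ℕ} (hn : n = K + 2 + m) (hK : 1 ≤ K) :
    2 * (derived n 1 (eDet n ![K + 2, K + 2, 1]) ^ 2 -
      eDet n ![K + 2, K + 2, 1] * derived n 2 (eDet n ![K + 2, K + 2, 1])) ∈ schurCone n := by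
  have key : 2 * (derived n 1 (eDet n ![K + 2, K + 2, 1]) ^ 2 -
      eDet n ![K + 2, K + 2, 1] * derived n 2 (eDet n ![K + 2, K + 2, 1])) =
      (2 * ((K + m + 4) * (K + 2) + (m + 2) ^ 2)) •
        (eDet n ![K + 2, K + 2] * eDet n ![K + 2, K + 2]) +
      (2 * (m + 2) * (K + 2)) • (eDet n ![K + 3, K + 3] * eDet n ![K + 1, K + 1]) +
      (2 * (K + m + 4) * (m + 2)) • (eDet n ![K + 2, K + 2] * eDet n ![K + 2, K + 1, 1]) +
      ((m + 2) * (m + 3)) • (eDet n ![K + 1, K + 1] * eDet n ![K + 2, K + 2, 2] +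
        eDet n ![K + 2, K + 2] * eDet n ![K + 1, K + 1, 1, 1] +
        eDet n ![K + 3, 1] * eDet n ![K + 1, K + 1, K + 1, 1]) +
      ((m + 2) * (m + 1)) • (eDet n ![K, 1] * eDet n ![K + 2, K + 2, K + 2, 1] +
        eDet n ![K + 1, K + 1] * eDet n ![K + 3, K + 1, 2] +
        eDet n ![K + 3, K + 1] * eDet n ![K + 1, K + 1, 1, 1]) := by
    rw [mul_sub, mul_left_comm, two_mul_derived_two_eDet hn, derived_one_eDet hn]
    simp only [nsmul_eq_mul]
    push_cast
    linear_combination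
      (-2 * ((K : MvPolynomial (Fin n) ℚ) + m + 4) * (m + 2)) * eDet_columns_mul_eDet_two n K +
      ((m : MvPolynomial (Fin n) ℚ) + 2) * (m + 3) * eDet_sq_sub_eDet_columns_mul₁ n K +
      ((m : MvPolynomial (Fin n) ℚ) + 2) * (m + 1) * eDet_sq_sub_eDet_columns_mul₂ n K
  rw [key]
  refine add_mem (add_mem (add_mem (add_mem ?_ ?_) ?_) ?_) ?_ <;> refine nsmul_mem ?_ _ <;>
    (try refine add_mem (add_mem ?_ ?_) ?_) <;>
    refine eDet_two_mul_mem_schurCone (by omega) (eDet_mem_schurCone ?_) <;>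
    simp [Fin.antitone_iff_succ_le, Fin.forall_fin_succ] <;> omega

/-- for `λ = (3, 2^(k-1))` with `k ≥ 3` and `n ≥ k` variables,
`(s_λ^{(1)})^2 - s_λ * s_λ^{(2)}` is Schur positive. -/
theorem conj_kk1_schur_positive (k n : ℕ) (hk : 3 ≤ k) (hn : k ≤ n) :
    SchurPositive n
      ((derived n 1 (schur n (fun i => if i = 0 then 3 else if i < k then 2 else 0))) ^ 2 -
        schur n (fun i => if i = 0 then 3 else if i < k then 2 else 0) *
          derived n 2 (schur n (fun i => if i = 0 then 3 else if i < k then 2 else 0))) := by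
  obtain ⟨K, rfl⟩ : ∃ K, k = K + 2 := ⟨k - 2, by omega⟩
  obtain ⟨m, hm⟩ := Nat.exists_eq_add_of_le hn
  rw [schur_eq_eDet hn (by omega)]
  refine schurPositive_of_mem_schurCone ?_
  have h := Submodule.smul_mem _ (1 / 2 : ℚ≥0)
    (two_mul_derived_sq_sub_mem_schurCone hm (by omega))
  rwa [two_mul, ← two_smul ℚ≥0, smul_smul, one_div, inv_mul_cancel₀ two_ne_zero, one_smul] at h

end
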